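/- Let λ₆ be the 3-dimensional real Leibniz algebra with basis e_1, e_2, e_3 and bracket determined by [e_1, e_1] = e_2 and [e_2, e_1] = e_3 (all other products of basis elements zero). For x = (x_1, x_2, x_3) ∈ ℝ³ with x_1 x_2 < 0, the transposed approximation E^T_{λ₆,x} (the evolution algebra with structure matrix [[0,0,0],[2x_1,0,0],[x_2,x_1,0]]) is isomorphic to the 3-dimensional evolution algebra with structure matrix [[0,−1,−1],[0,0,0],[0,1,0]] (i.e. e_1·e_1 = −e_2 − e_3, e_3·e_3 = e_2, and all other products of basis elements zero). -/

import Mathlib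

open Matrix BigOperators

/-- Multiplication of the evolution algebra on `Fin n → ℝ` with structure matrix `M`. -/
def evolMul {n : ℕ} (M : Matrix (Fin n) (Fin n) ℝ) (u v : Fin n → ℝ) : Fin n → ℝ :=
  fun k => ∑ i, u i * v i * M i k

/-- Two evolution algebras (given by structure matrices) are isomorphic if there is a
bijective linear map `φ` with `φ (u·v) = φ u · φ v`. -/
def EvolIso {n : ℕ} (M N : Matrix (Fin n) (Fin n) ℝ) : Prop :=
  ∃ φ : (Fin n → ℝ) ≃ₗ[ℝ] (Fin n → ℝ),
    ∀ u v, φ (evolMul M u v) = evolMul N (φ u) (φ v)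

/-- For `a ≠ 0` the isomorphism sends `e₁ ↦ (a / 2) e₂`, `e₂ ↦ -(a + b / 2) e₂ - a e₃`
and `e₃ ↦ a e₁`. -/
theorem evolIso_of_ne_zero {a : ℝ} (ha : a ≠ 0) (b : ℝ) :
    EvolIso !![0, 0, 0; 2 * a, 0, 0; b, a, 0] !![0, -1, -1; 0, 0, 0; 0, 1, 0] := by
  refine ⟨{
    toFun := fun u => ![a * u 2, a / 2 * u 0 - (a + b / 2) * u 1, -a * u 1]
    invFun := fun w => ![2 / a * (w 1 - (a + b / 2) * w 2 / a), -w 2 / a, w 0 / a]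
    map_add' := fun u v => by
      ext k; fin_cases k <;> simp <;> ring
    map_smul' := fun r u => by
      ext k; fin_cases k <;> simp <;> ring
    left_inv := fun u => by
      ext k; fin_cases k <;> simp <;> field_simp
      ring
    right_inv := fun w => by
      ext k; fin_cases k <;> simp <;> field_simp
      ring }, fun u v => ?_⟩
  ext k
  fin_cases k <;> simp [evolMul, Fin.sum_univ_three] <;> ring

/-- Let `λ₆` be the 3-dimensional real Leibniz algebra with
`[e₁,e₁] = e₂`, `[e₂,e₁] = e₃` and all other products of basis elements zero, with
structure constants `γ`. For `x₁ x₂ < 0` its transposed approximation at `x`, the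
evolution algebra with structure matrix `[[0,0,0],[2x₁,0,0],[x₂,x₁,0]]`, is
isomorphic to the evolution algebra with structure matrix
`[[0,-1,-1],[0,0,0],[0,1,0]]`. -/
theorem stmt17 (γ : Fin 3 → Fin 3 → Fin 3 → ℝ)
    (hγ : γ = fun i j k =>
      if i = 0 ∧ j = 0 ∧ k = 1 then 1
      else if i = 1 ∧ j = 0 ∧ k = 2 then 1 else 0)
    (x : Fin 3 → ℝ) (hx : x 0 * x 1 < 0) :
    (Matrix.of fun p k => ∑ i, (γ k i p + γ i k p) * x i) =
      !![0, 0, 0; 2 * x 0, 0, 0; x 1, x 0, 0] ∧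
    EvolIso (Matrix.of fun p k => ∑ i, (γ k i p + γ i k p) * x i)
      !![0, -1, -1; 0, 0, 0; 0, 1, 0] := by
  have hM : (Matrix.of fun p k => ∑ i, (γ k i p + γ i k p) * x i) =
      !![0, 0, 0; 2 * x 0, 0, 0; x 1, x 0, 0] := by
    subst hγ
    ext p k
    fin_cases p <;> fin_cases k <;> simp [Fin.sum_univ_three, two_mul, add_mul]
  refine ⟨hM, ?_⟩
  rw [hM]
  exact evolIso_of_ne_zero (left_ne_zero_of_mul hx.ne) (x 1)
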